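/- Let n ≥ 1 and let x, y, z, u_1, u_2, u_3, u_4, u_5, α be elements of a commutative ring satisfying x + y = u_3 + u_4, y + z = u_3 + u_5 and x·y = u_1·u_2. Then ∑_{σ∈PRW_{n+1}} (u_1 u_2)^{M(σ)} u_3^{da(σ)} u_4^{dd(σ)−LRmin(σ)+1} u_5^{LRmin(σ)−1} α^{LRmin(σ)+RLmin(σ)−2} = ∑_{σ∈PRW_{n+1}} x^{des(σ)−LRmin(σ)+1} y^{asc(σ)} z^{LRmin(σ)−1} α^{LRmin(σ)+RLmin(σ)−2}. -/

import Mathlib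

/-- The letter at (1-based) position `i` of the word `w`, with the boundary
convention that positions `0` and `> w.length` carry the value `w.length + 1`
(playing the role of `+∞` for a permutation word of `{1,…,n}`). -/
def wB (w : List ℕ) (i : ℕ) : ℕ :=
  if 1 ≤ i ∧ i ≤ w.length then w.getD (i - 1) 0 else w.length + 1

/-- The one-line word `σ_1 ⋯ σ_n` (with letters in `{1,…,n}`) of a permutation of `Fin n`. -/
def word {n : ℕ} (σ : Equiv.Perm (Fin n)) : List ℕ := List.ofFn (fun i => (σ i : ℕ) + 1)

/-- Number of descents: indices `i ∈ {1,…,n-1}` with `σ_i > σ_{i+1}`. -/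
def desW (w : List ℕ) : ℕ :=
  ((Finset.Icc 1 (w.length - 1)).filter (fun i => wB w (i + 1) < wB w i)).card

/-- Number of ascents: indices `i ∈ {1,…,n-1}` with `σ_i < σ_{i+1}`. -/
def ascW (w : List ℕ) : ℕ :=
  ((Finset.Icc 1 (w.length - 1)).filter (fun i => wB w i < wB w (i + 1))).card

/-- Position `i` is a double ascent: `σ_{i-1} < σ_i < σ_{i+1}` (boundary `σ_0 = σ_{n+1} = +∞`). -/
abbrev isDAat (w : List ℕ) (i : ℕ) : Prop := wB w (i - 1) < wB w i ∧ wB w i < wB w (i + 1)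

/-- Position `i` is a double descent: `σ_{i-1} > σ_i > σ_{i+1}`. -/
abbrev isDDat (w : List ℕ) (i : ℕ) : Prop := wB w i < wB w (i - 1) ∧ wB w (i + 1) < wB w i

/-- Position `i` is a peak: `σ_{i-1} < σ_i > σ_{i+1}`. -/
abbrev isPkat (w : List ℕ) (i : ℕ) : Prop := wB w (i - 1) < wB w i ∧ wB w (i + 1) < wB w i

/-- Position `i` is a valley: `σ_{i-1} > σ_i < σ_{i+1}`. -/
abbrev isVlat (w : List ℕ) (i : ℕ) : Prop := wB w i < wB w (i - 1) ∧ wB w i < wB w (i + 1)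

/-- Position `i` holds a left-to-right minimum: `σ_j > σ_i` for all `j < i`. -/
abbrev isLRat (w : List ℕ) (i : ℕ) : Prop := ∀ j ∈ Finset.Icc 1 (i - 1), wB w i < wB w j

/-- Position `i` holds a right-to-left minimum: `σ_j > σ_i` for all `j > i`. -/
abbrev isRLat (w : List ℕ) (i : ℕ) : Prop := ∀ j ∈ Finset.Icc (i + 1) w.length, wB w i < wB w j

/-- `da`, the number of double ascents. -/
def daW (w : List ℕ) : ℕ := ((Finset.Icc 1 w.length).filter (isDAat w)).card

/-- `dd`, the number of double descents. -/
def ddW (w : List ℕ) : ℕ := ((Finset.Icc 1 w.length).filter (isDDat w)).card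

/-- `M`, the number of peaks. -/
def pkW (w : List ℕ) : ℕ := ((Finset.Icc 1 w.length).filter (isPkat w)).card

/-- `LRmin`, the number of left-to-right minima. -/
def lrminW (w : List ℕ) : ℕ := ((Finset.Icc 1 w.length).filter (isLRat w)).card

/-- `RLmin`, the number of right-to-left minima. -/
def rlminW (w : List ℕ) : ℕ := ((Finset.Icc 1 w.length).filter (isRLat w)).card

/-- The word belongs to `PRW`: if it has an ascent, the first ascent occurs at the letter `1`. -/
abbrev isPRW (w : List ℕ) : Prop :=
  ∀ i ∈ Finset.Icc 1 (w.length - 1), wB w i < wB w (i + 1) →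
    (∀ j ∈ Finset.Icc 1 (i - 1), ¬ wB w j < wB w (j + 1)) → wB w i = 1

/-- The set `PRW_n` of permutations whose first ascent (if any) appears at the letter `1`. -/
def PRW (n : ℕ) : Finset (Equiv.Perm (Fin n)) :=
  Finset.univ.filter (fun σ => isPRW (word σ))

section Weights

variable {R : Type*} [CommRing R]
variable {K : Type*} [CommSemiring K] [Algebra K R]

/-- The weight of a word preceded by the letter `q` and followed by `+∞`: each peak contributes
`p`, each double ascent `a`, each double descent `b` and each right-to-left minimum `α`. -/
def tailWeight (p a b α : R) : ℕ → List ℕ → R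
  | _, [] => 1
  | q, x :: r =>
    (if q < x then (if x < r.headD (x + 1) then a else p)
      else (if x < r.headD (x + 1) then 1 else b)) *
    (if ∀ y ∈ r, x < y then α else 1) * tailWeight p a b α x r

/-- The weight of a word containing the letter `1`: zero unless the letters decrease up to `1`, and
otherwise `c * α` for each letter before `1` times the weight of what follows `1`. -/
def prwWeight (p a b c α : R) : List ℕ → R
  | [] => 0
  | x :: r =>
    if x = 1 then tailWeight p a b α x r
    else if x < r.headD (x + 1) then 0 else c * α * prwWeight p a b c α r

/-- The word `n ⋯ 2 1`. -/
def descWord : ℕ → List ℕ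
  | 0 => []
  | n + 1 => (n + 1) :: descWord n

/-- The generating function of `prwWeight` over all permutations of `{1,…,n}`. -/
def prwSum (p a b c α : R) (n : ℕ) : R :=
  ((descWord n).permutations'.map (prwWeight p a b c α)).sum

theorem perm_of_mem_permutations'Aux {β : Type*} {m : β} {s t : List β}
    (h : t ∈ s.permutations'Aux m) : t.Perm (m :: s) := by
  rw [← List.mem_permutations', List.permutations', List.mem_flatMap]
  exact ⟨s, List.mem_permutations'.2 (List.Perm.refl s), h⟩

theorem sum_tailWeight_permutations'Aux {p a b α : R} {δ : Derivation K R R}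
    (ha : δ a = p) (hb : δ b = p) (hp : δ p = p * (a + b)) (hα : δ α = 0) {m : ℕ} (w : List ℕ) :
    ∀ q, q < m → (∀ y ∈ w, y < m) →
      ((w.permutations'Aux m).map (tailWeight p a b α q)).sum =
        α * a * tailWeight p a b α q w + δ (tailWeight p a b α q w) +
          (if q < w.headD (q + 1) then 0 else p * tailWeight p a b α q w) := by
  induction w with
  | nil =>
    intro q hq _
    simp [tailWeight, List.permutations'Aux, hq, mul_comm]
  | cons x r ih =>
    intro q hq hw
    have hx : x < m := hw x (by simp)
    have ihx := ih x hx (fun y hy => hw y (by simp [hy]))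
    have hα' : δ (if ∀ y ∈ r, x < y then α else 1) = 0 := by split_ifs <;> simp [hα]
    cases r with
    | nil =>
      simp only [tailWeight, List.permutations'Aux, List.map_cons, List.map_nil, List.sum_cons,
        List.sum_nil, List.headD_cons, List.headD_nil]
      by_cases h : q < x <;>
        simp [h, hq, hx, hx.not_gt, ha, hα, Derivation.leibniz] <;> ring
    | cons y s =>
      have hy : y < m := hw y (by simp)
      have key : ∀ t ∈ s.permutations'Aux m, tailWeight p a b α q (x :: y :: t) =
          (if q < x then (if x < y then a else p) else (if x < y then 1 else b)) *
            (if ∀ z ∈ y :: s, x < z then α else 1) * tailWeight p a b α x (y :: t) := by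
        intro t ht
        have : (∀ z ∈ y :: t, x < z) ↔ ∀ z ∈ y :: s, x < z := by
          simp only [List.forall_mem_cons, (perm_of_mem_permutations'Aux ht).mem_iff, hx, true_and]
        rw [tailWeight]
        by_cases h : ∀ z ∈ y :: s, x < z
        · simp only [if_pos h, if_pos (this.2 h)]
          rfl
        · simp only [if_neg h, if_neg (mt this.1 h)]
          rfl
      have hfront : tailWeight p a b α q (m :: x :: y :: s) =
          p * tailWeight p a b α m (x :: y :: s) := by
        rw [tailWeight]
        simp [hq, hx.not_gt]
      have hsecond : tailWeight p a b α q (x :: m :: y :: s) = (if q < x then a else 1) *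
          (if ∀ z ∈ y :: s, x < z then α else 1) * (p * tailWeight p a b α m (y :: s)) := by
        rw [tailWeight, tailWeight]
        simp [hx, hy.not_gt]
      have htail : tailWeight p a b α x (m :: y :: s) = p * tailWeight p a b α m (y :: s) := by
        rw [tailWeight]
        simp [hx, hy.not_gt]
      have hlarge : tailWeight p a b α m (x :: y :: s) = (if x < y then 1 else b) *
          (if ∀ z ∈ y :: s, x < z then α else 1) * tailWeight p a b α x (y :: s) := by
        rw [tailWeight]
        simp [hx.not_gt]
      have hcons : tailWeight p a b α q (x :: y :: s) =
          (if q < x then (if x < y then a else p) else (if x < y then 1 else b)) *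
          (if ∀ z ∈ y :: s, x < z then α else 1) * tailWeight p a b α x (y :: s) := by
        rw [tailWeight]
        simp
      have hleft : ¬ x < y → tailWeight p a b α x (y :: s) = tailWeight p a b α m (y :: s) := by
        intro h
        rw [tailWeight, tailWeight]
        simp only [h, hy.not_gt]
      simp only [List.permutations'Aux, List.map_cons, List.map_map, List.sum_cons,
        List.headD_cons, Function.comp_def] at ihx ⊢
      rw [List.map_congr_left key, List.sum_map_mul_left, hfront, hsecond, hlarge, hcons]
      rw [htail] at ihx
      generalize (if ∀ z ∈ y :: s, x < z then α else 1) = ρ at *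
      generalize (List.map (fun t => tailWeight p a b α x (y :: t)) (s.permutations'Aux m)).sum = S
        at *
      have hS := eq_sub_of_add_eq' ihx
      rw [hS]
      by_cases h2 : x < y
      · by_cases h1 : q < x <;>
          simp only [h1, h2, if_true, if_false, Derivation.leibniz, ha, hα', smul_eq_mul,
            Derivation.map_one_eq_zero] <;> ring
      · rw [← hleft h2]
        by_cases h1 : q < x <;>
          simp only [h1, h2, if_true, if_false, Derivation.leibniz, hb, hp, hα', smul_eq_mul] <;>
          ring

theorem sum_prwWeight_permutations'Aux {p a b c α : R} {δ : Derivation K R R}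
    (ha : δ a = p) (hb : δ b = p) (hp : δ p = p * (a + b)) (hc : δ c = 0) (hα : δ α = 0)
    {m : ℕ} (hm : 1 < m) (w : List ℕ) (hnd : w.Nodup) (h1 : 1 ∈ w)
    (hw : ∀ y ∈ w, 1 ≤ y ∧ y < m) :
    ((w.permutations'Aux m).map (prwWeight p a b c α)).sum =
      α * (a + c) * prwWeight p a b c α w + δ (prwWeight p a b c α w) := by
  induction w with
  | nil => simp at h1
  | cons x r ih =>
    have hx := hw x (by simp)
    have hfront : prwWeight p a b c α (m :: x :: r) = c * α * prwWeight p a b c α (x :: r) := by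
      rw [prwWeight]
      simp [hm.ne', hx.2.not_gt]
    by_cases hx1 : x = 1
    · subst hx1
      have hhead : 1 < r.headD (1 + 1) := by
        cases r with
        | nil => simp
        | cons y s =>
          have := hw y (by simp)
          have : (1 : ℕ) ≠ y := fun h => hnd.notMem (by simp [h])
          rw [List.headD_cons]
          omega
      have := sum_tailWeight_permutations'Aux ha hb hp hα r 1 hm (fun y hy => (hw y (by simp [hy])).2)
      rw [if_pos hhead, add_zero] at this
      have hone (t : List ℕ) : prwWeight p a b c α (1 :: t) = tailWeight p a b α 1 t := by
        rw [prwWeight, if_pos rfl]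
      simp only [List.permutations'Aux, List.map_cons, List.map_map, List.sum_cons,
        Function.comp_def, hfront, hone, this]
      ring
    · have hr : 1 ∈ r := by simpa [Ne.symm hx1] using h1
      cases r with
      | nil => simp at hr
      | cons y s =>
        have ih' := ih hnd.of_cons hr (fun z hz => hw z (by simp [hz]))
        have hy := hw y (by simp)
        have hfront' : prwWeight p a b c α (m :: y :: s) = c * α * prwWeight p a b c α (y :: s) := by
          rw [prwWeight]
          simp [hm.ne', hy.2.not_gt]
        have hsecond : prwWeight p a b c α (x :: m :: y :: s) = 0 := by
          rw [prwWeight]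
          simp [hx1, hx.2]
        have hrest : ∀ t, prwWeight p a b c α (x :: y :: t) =
            (if x < y then 0 else c * α) * prwWeight p a b c α (y :: t) := by
          intro t
          rw [prwWeight]
          simp [hx1]
        simp only [List.permutations'Aux, List.map_cons, List.map_map, List.sum_cons,
          Function.comp_def] at ih' ⊢
        rw [hfront, hsecond]
        simp only [hrest, List.sum_map_mul_left]
        rw [hfront'] at ih'
        rw [eq_sub_of_add_eq' ih']
        by_cases h : x < y
        · simp [h]
        · simp [h, Derivation.leibniz, hc, hα]
          ring


theorem mem_descWord {n y : ℕ} : y ∈ descWord n ↔ 1 ≤ y ∧ y ≤ n := by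
  induction n with
  | zero => simp [descWord]; omega
  | succ n ih => simp [descWord, ih]; omega

theorem nodup_descWord (n : ℕ) : (descWord n).Nodup := by
  induction n with
  | zero => simp [descWord]
  | succ n ih => simp [descWord, ih, mem_descWord]

theorem prwSum_one (p a b c α : R) : prwSum p a b c α 1 = 1 := by
  simp [prwSum, descWord, prwWeight, tailWeight, List.permutations'Aux]

theorem prwSum_add_two {p a b c α : R} {δ : Derivation K R R}
    (ha : δ a = p) (hb : δ b = p) (hp : δ p = p * (a + b)) (hc : δ c = 0) (hα : δ α = 0) (n : ℕ) :
    prwSum p a b c α (n + 2) =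
      α * (a + c) * prwSum p a b c α (n + 1) + δ (prwSum p a b c α (n + 1)) := by
  have key : ∀ w ∈ (descWord (n + 1)).permutations',
      ((w.permutations'Aux (n + 2)).map (prwWeight p a b c α)).sum =
        α * (a + c) * prwWeight p a b c α w + δ (prwWeight p a b c α w) := by
    intro w hw
    have hperm := List.mem_permutations'.1 hw
    refine sum_prwWeight_permutations'Aux ha hb hp hc hα (by omega) w
      (hperm.nodup_iff.2 (nodup_descWord _)) ?_ ?_
    · simp [hperm.mem_iff, mem_descWord]
    · intro y hy
      rw [hperm.mem_iff, mem_descWord] at hy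
      omega
  have hsplit : ∀ l : List (List ℕ), (∀ w ∈ l,
      ((w.permutations'Aux (n + 2)).map (prwWeight p a b c α)).sum =
        α * (a + c) * prwWeight p a b c α w + δ (prwWeight p a b c α w)) →
      ((l.flatMap (List.permutations'Aux (n + 2))).map (prwWeight p a b c α)).sum =
        α * (a + c) * (l.map (prwWeight p a b c α)).sum +
          δ (l.map (prwWeight p a b c α)).sum := by
    intro l
    induction l with
    | nil => simp
    | cons w l ih =>
      intro h
      rw [List.flatMap_cons, List.map_append, List.sum_append, h w (by simp),
        ih (fun v hv => h v (by simp [hv])), List.map_cons, List.sum_cons, map_add]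
      ring
  exact hsplit _ key

theorem map_tailWeight {S : Type*} [CommRing S] (f : R →+* S) (p a b α : R) (w : List ℕ) :
    ∀ q, f (tailWeight p a b α q w) = tailWeight (f p) (f a) (f b) (f α) q w := by
  induction w with
  | nil => simp [tailWeight]
  | cons x r ih =>
    intro q
    rw [tailWeight, tailWeight, map_mul, map_mul, ih]
    congr 2 <;> split_ifs <;> simp

theorem map_prwWeight {S : Type*} [CommRing S] (f : R →+* S) (p a b c α : R) (w : List ℕ) :
    f (prwWeight p a b c α w) = prwWeight (f p) (f a) (f b) (f c) (f α) w := by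
  induction w with
  | nil => simp [prwWeight]
  | cons x r ih =>
    rw [prwWeight, prwWeight]
    split_ifs <;> simp [map_tailWeight, ih]

theorem map_prwSum {S : Type*} [CommRing S] (f : R →+* S) (p a b c α : R) (n : ℕ) :
    f (prwSum p a b c α n) = prwSum (f p) (f a) (f b) (f c) (f α) n := by
  simp only [prwSum, map_list_sum, List.map_map]
  congr 1
  exact List.map_congr_left fun w _ => map_prwWeight f p a b c α w

open MvPolynomial in
theorem exists_prwSum_eq_aeval (n : ℕ) : ∃ E : MvPolynomial (Fin 4) ℤ,
    prwSum (X 0 : MvPolynomial (Fin 5) ℤ) (X 1) (X 2) (X 3) (X 4) (n + 1) =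
      aeval ![X 0, X 1 + X 2, X 1 + X 3, X 4] E := by
  set φ : MvPolynomial (Fin 4) ℤ →ₐ[ℤ] MvPolynomial (Fin 5) ℤ :=
    aeval ![X 0, X 1 + X 2, X 1 + X 3, X 4] with hφ
  let δ : Derivation ℤ (MvPolynomial (Fin 5) ℤ) (MvPolynomial (Fin 5) ℤ) :=
    mkDerivation ℤ ![X 0 * (X 1 + X 2), X 0, X 0, 0, 0]
  let d : Derivation ℤ (MvPolynomial (Fin 4) ℤ) (MvPolynomial (Fin 4) ℤ) :=
    mkDerivation ℤ ![X 0 * X 1, X 0 + X 0, X 0, 0]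
  have hδ (i : Fin 5) :
      δ (X i) = (![X 0 * (X 1 + X 2), X 0, X 0, 0, 0] : Fin 5 → MvPolynomial (Fin 5) ℤ) i :=
    mkDerivation_X ..
  have hd (i : Fin 4) :
      d (X i) = (![X 0 * X 1, X 0 + X 0, X 0, 0] : Fin 4 → MvPolynomial (Fin 4) ℤ) i :=
    mkDerivation_X ..
  have hφX (i : Fin 4) :
      φ (X i) = (![X 0, X 1 + X 2, X 1 + X 3, X 4] : Fin 4 → MvPolynomial (Fin 5) ℤ) i :=
    aeval_X ..
  have hcomm (E : MvPolynomial (Fin 4) ℤ) : δ (φ E) = φ (d E) := by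
    induction E using MvPolynomial.induction_on with
    | C r => simp [← algebraMap_eq]
    | add f g hf hg => simp [hf, hg]
    | mul_X f i hf =>
      have hi : δ (φ (X i)) = φ (d (X i)) := by
        fin_cases i <;> simp [hφX, hd, hδ]
      simp [Derivation.leibniz, hf, hi]
  induction n with
  | zero => exact ⟨1, by rw [prwSum_one, map_one]⟩
  | succ n ih =>
    obtain ⟨E, hE⟩ := ih
    refine ⟨X 3 * X 2 * E + d E, ?_⟩
    rw [prwSum_add_two (p := X 0) (a := X 1) (b := X 2) (c := X 3) (α := X 4) (δ := δ)
      (hδ 1) (hδ 2) (hδ 0) (hδ 3) (hδ 4), hE, hcomm]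
    simp [hφX]

open MvPolynomial in
theorem prwSum_eq_of_add_eq {p a b c a' b' c' : R} (α : R) (hab : a + b = a' + b')
    (hac : a + c = a' + c') (n : ℕ) :
    prwSum p a b c α (n + 1) = prwSum p a' b' c' α (n + 1) := by
  obtain ⟨E, hE⟩ := exists_prwSum_eq_aeval n
  have key (a b c : R) : prwSum p a b c α (n + 1) = aeval ![p, a + b, a + c, α] E := by
    have := congrArg (aeval ![p, a, b, c, α] : MvPolynomial (Fin 5) ℤ →ₐ[ℤ] R).toRingHom hE
    rw [map_prwSum] at this
    simp only [AlgHom.toRingHom_eq_coe, RingHom.coe_coe, aeval_X] at this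
    refine this.trans ?_
    rw [← AlgHom.comp_apply]
    congr 1
    ext i
    fin_cases i <;> simp
  rw [key, key, hab, hac]

end Weights

section Statistics

theorem card_filter_Icc_one_succ (P : ℕ → Prop) [DecidablePred P] (n : ℕ) :
    ((Finset.Icc 1 (n + 1)).filter P).card =
      (if P 1 then 1 else 0) + ((Finset.Icc 1 n).filter (fun i => P (i + 1))).card := by
  have h : Finset.Icc 1 (n + 1) = insert 1 ((Finset.Icc 1 n).map (addRightEmbedding 1)) := by
    rw [Finset.map_add_right_Icc]
    ext i
    simp
    omega
  rw [h, Finset.filter_insert, Finset.filter_map]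
  split_ifs
  · rw [Finset.card_insert_of_notMem (by simp), Finset.card_map, add_comm]
    rfl
  · rw [Finset.card_map, zero_add]
    rfl

theorem wB_eq_getD (w : List ℕ) (i : ℕ) :
    wB w i = ((w.length + 1) :: w).getD i (w.length + 1) := by
  cases i with
  | zero => simp [wB]
  | succ i =>
    by_cases h : i + 1 ≤ w.length
    · have h' : i < w.length := h
      simp [wB, h, h']
    · have h' : w.length ≤ i := by omega
      simp [wB, h]

theorem wB_cons_one (x : ℕ) (r : List ℕ) : wB (x :: r) 1 = x := by
  simp [wB]

theorem wB_cons_succ (x : ℕ) {r : List ℕ} {i : ℕ} (h1 : 1 ≤ i) (h2 : i ≤ r.length) :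
    wB (x :: r) (i + 1) = wB r i := by
  obtain ⟨k, rfl⟩ := Nat.exists_eq_add_of_le' h1
  have h : k < r.length := h2
  simp [wB, h]

theorem wB_eq_getElem {w : List ℕ} {i : ℕ} (h : i < w.length) : wB w (i + 1) = w[i] := by
  simp [wB, h]

theorem wB_mem {w : List ℕ} {i : ℕ} (h1 : 1 ≤ i) (h2 : i ≤ w.length) : wB w i ∈ w := by
  obtain ⟨k, rfl⟩ := Nat.exists_eq_add_of_le' h1
  rw [wB_eq_getElem h2]
  exact List.getElem_mem _

theorem forall_wB_iff {w : List ℕ} {P : ℕ → Prop} :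
    (∀ i, 1 ≤ i → i ≤ w.length → P (wB w i)) ↔ ∀ y ∈ w, P y := by
  refine ⟨fun h y hy => ?_, fun h i h1 h2 => h _ (wB_mem h1 h2)⟩
  obtain ⟨k, hk, rfl⟩ := List.mem_iff_getElem.1 hy
  rw [← wB_eq_getElem hk]
  exact h _ (by omega) hk

theorem rlminW_cons (x : ℕ) (r : List ℕ) :
    rlminW (x :: r) = (if ∀ y ∈ r, x < y then 1 else 0) + rlminW r := by
  refine (card_filter_Icc_one_succ (isRLat (x :: r)) r.length).trans ?_
  rw [rlminW]
  have shift (i : ℕ) : isRLat (x :: r) (i + 1) ↔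
      ∀ j, i + 1 ≤ j → j ≤ r.length → wB (x :: r) (i + 1) < wB r j := by
    simp only [isRLat, Finset.mem_Icc, List.length_cons]
    refine ⟨fun h j h1 h2 => ?_, fun h j hj => ?_⟩
    · rw [← wB_cons_succ x (by omega) h2]
      exact h _ (by omega)
    · obtain ⟨k, rfl⟩ := Nat.exists_eq_add_of_le' (show 1 ≤ j by omega)
      rw [wB_cons_succ (i := k) x (by omega) (by omega)]
      exact h _ (by omega) (by omega)
  congr 1
  · refine if_congr ?_ rfl rfl
    rw [show (1 : ℕ) = 0 + 1 from rfl, shift, ← forall_wB_iff]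
    simp [wB_cons_one]
  · congr 1
    refine Finset.filter_congr fun i hi => ?_
    rw [Finset.mem_Icc] at hi
    rw [shift, wB_cons_succ x hi.1 hi.2]
    simp [isRLat]

theorem lrminW_one_cons {r : List ℕ} (h : ∀ y ∈ r, 1 < y) : lrminW (1 :: r) = 1 := by
  rw [lrminW, List.length_cons, card_filter_Icc_one_succ, Finset.filter_false_of_mem]
  · simp
  · intro i hi hlr
    rw [Finset.mem_Icc] at hi
    have h1 := hlr 1 (by simp; omega)
    rw [wB_cons_one, wB_cons_succ 1 hi.1 hi.2] at h1
    have := h _ (wB_mem hi.1 hi.2)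
    omega

theorem lrminW_cons_cons {x y : ℕ} {s : List ℕ} (h : y < x) :
    lrminW (x :: y :: s) = 1 + lrminW (y :: s) := by
  rw [lrminW, List.length_cons, card_filter_Icc_one_succ, lrminW]
  congr 1
  · congr 1
    refine Finset.filter_congr fun i hi => ?_
    rw [Finset.mem_Icc] at hi
    simp only [isLRat, Finset.mem_Icc, wB_cons_succ x hi.1 hi.2]
    refine ⟨fun H j hj => ?_, fun H j hj => ?_⟩
    · rw [← wB_cons_succ x hj.1 (by omega)]
      exact H _ (by omega)
    · rcases Nat.lt_or_ge j 2 with hj2 | hj2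
      · obtain rfl : j = 1 := by omega
        rw [wB_cons_one]
        rcases Nat.lt_or_ge i 2 with hi2 | hi2
        · obtain rfl : i = 1 := by omega
          rwa [wB_cons_one]
        · have := H 1 (by omega)
          rw [wB_cons_one] at this
          omega
      · obtain ⟨k, rfl⟩ := Nat.exists_eq_add_of_le' hj.1
        rw [wB_cons_succ x (by omega) (by omega)]
        exact H _ (by omega)

theorem isPRW_one_cons {r : List ℕ} (h : ∀ y ∈ r, 1 < y) : isPRW (1 :: r) := by
  intro i hi _ hfirst
  rw [Finset.mem_Icc, List.length_cons] at hi
  by_contra hne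
  have hi1 : i ≠ 1 := fun h => hne (by rw [h, wB_cons_one])
  refine hfirst 1 (by simp; omega) ?_
  rw [wB_cons_one, wB_cons_succ 1 le_rfl (by omega)]
  exact h _ (wB_mem le_rfl (by omega))

theorem isPRW_cons_cons {x y : ℕ} {s : List ℕ} (hx : x ≠ 1) :
    isPRW (x :: y :: s) ↔ ¬ x < y ∧ isPRW (y :: s) := by
  have h2 : wB (x :: y :: s) (1 + 1) = y := by
    rw [wB_cons_succ x le_rfl (by simp), wB_cons_one]
  simp only [isPRW, Finset.mem_Icc, List.length_cons]
  constructor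
  · intro H
    have hxy : ¬ x < y := by
      intro h
      refine hx ?_
      have := H 1 (by omega) (by rwa [wB_cons_one, h2]) (fun j hj => by omega)
      rwa [wB_cons_one] at this
    refine ⟨hxy, fun i hi hasc hfirst => ?_⟩
    have := H (i + 1) (by omega)
      (by rwa [wB_cons_succ x (by omega) (by simp; omega),
        wB_cons_succ x (by omega) (by simp; omega)])
      (fun j hj => by
        rcases Nat.lt_or_ge j 2 with hj2 | hj2
        · obtain rfl : j = 1 := by omega
          rwa [wB_cons_one, h2]
        · obtain ⟨k, rfl⟩ := Nat.exists_eq_add_of_le' hj.1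
          rw [wB_cons_succ x (by omega) (by simp; omega),
            wB_cons_succ x (by omega) (by simp; omega)]
          exact hfirst k (by omega))
    rwa [wB_cons_succ x (by omega) (by simp; omega)] at this
  · rintro ⟨hxy, H⟩ i hi hasc hfirst
    have hi1 : i ≠ 1 := by
      rintro rfl
      rw [wB_cons_one, h2] at hasc
      exact hxy hasc
    obtain ⟨k, rfl⟩ := Nat.exists_eq_add_of_le' hi.1
    rw [wB_cons_succ x (by omega) (by simp; omega)] at hasc ⊢
    rw [wB_cons_succ x (by omega) (by simp; omega)] at hasc
    refine H k (by omega) hasc fun j hj => ?_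
    have := hfirst (j + 1) (by omega)
    rwa [wB_cons_succ x (by omega) (by simp; omega),
      wB_cons_succ x (by omega) (by simp; omega)] at this

/-- The number of letters `x` of `w` satisfying `P l x r`, where `l` and `r` are the letters
adjacent to `x` in the word `w` preceded by `q` and followed by `N`. -/
def letterCount (P : ℕ → ℕ → ℕ → Prop) [∀ l x r, Decidable (P l x r)] (N q : ℕ) (w : List ℕ) : ℕ :=
  ((Finset.Icc 1 w.length).filter (fun i =>
    P ((q :: w).getD (i - 1) N) ((q :: w).getD i N) ((q :: w).getD (i + 1) N))).card

theorem letterCount_nil (P : ℕ → ℕ → ℕ → Prop) [∀ l x r, Decidable (P l x r)] (N q : ℕ) :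
    letterCount P N q [] = 0 := by
  simp [letterCount]

theorem letterCount_cons (P : ℕ → ℕ → ℕ → Prop) [∀ l x r, Decidable (P l x r)]
    (N q x : ℕ) (r : List ℕ) :
    letterCount P N q (x :: r) =
      (if P q x (r.headD N) then 1 else 0) + letterCount P N x r := by
  rw [letterCount, List.length_cons, card_filter_Icc_one_succ, letterCount]
  congr 1
  · cases r <;> simp
  · congr 1
    refine Finset.filter_congr fun i hi => ?_
    obtain ⟨k, rfl⟩ := Nat.exists_eq_add_of_le' (Finset.mem_Icc.1 hi).1
    simp

/-- The condition that the letter `x` between `l` and `r` is a peak. -/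
abbrev IsPeak (l x r : ℕ) : Prop := l < x ∧ r < x

/-- The condition that the letter `x` between `l` and `r` is a double ascent. -/
abbrev IsDoubleAscent (l x r : ℕ) : Prop := l < x ∧ x < r

/-- The condition that the letter `x` between `l` and `r` is a double descent. -/
abbrev IsDoubleDescent (l x r : ℕ) : Prop := x < l ∧ r < x

theorem pkW_eq_letterCount (w : List ℕ) :
    pkW w = letterCount IsPeak (w.length + 1) (w.length + 1) w := by
  simp only [pkW, isPkat, letterCount, IsPeak, wB_eq_getD]

theorem daW_eq_letterCount (w : List ℕ) :
    daW w = letterCount IsDoubleAscent (w.length + 1) (w.length + 1) w := by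
  simp only [daW, isDAat, letterCount, IsDoubleAscent, wB_eq_getD]

theorem ddW_eq_letterCount (w : List ℕ) :
    ddW w = letterCount IsDoubleDescent (w.length + 1) (w.length + 1) w := by
  simp only [ddW, isDDat, letterCount, IsDoubleDescent, wB_eq_getD]

variable {R : Type*} [CommRing R]

theorem tailWeight_eq (p a b α : R) {N : ℕ} (w : List ℕ) : ∀ q, (q :: w).Nodup →
    (∀ y ∈ w, y < N) →
    tailWeight p a b α q w = p ^ letterCount IsPeak N q w * a ^ letterCount IsDoubleAscent N q w *
      b ^ letterCount IsDoubleDescent N q w * α ^ rlminW w := by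
  induction w with
  | nil => simp [tailWeight, letterCount_nil, rlminW]
  | cons x r ih =>
    intro q hnd hN
    have hqx : q ≠ x := by
      rintro rfl
      exact hnd.notMem (by simp)
    have hxN : x < N := hN x (by simp)
    have hasc : x < r.headD (x + 1) ↔ x < r.headD N := by
      cases r <;> simp [hxN]
    have hne : x ≠ r.headD N := by
      cases r with
      | nil => exact hxN.ne
      | cons y s =>
        rintro rfl
        exact hnd.of_cons.notMem (by simp)
    rw [tailWeight, ih x hnd.of_cons (fun y hy => hN y (by simp [hy])), letterCount_cons,
      letterCount_cons, letterCount_cons, rlminW_cons]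
    simp only [hasc, IsPeak, IsDoubleAscent, IsDoubleDescent, pow_add]
    generalize r.headD N = t at *
    have hρ : (α ^ if ∀ y ∈ r, x < y then 1 else 0) = if ∀ y ∈ r, x < y then α else 1 := by
      split_ifs <;> simp
    rw [hρ]
    generalize (if ∀ y ∈ r, x < y then α else 1) = ρ
    rcases lt_or_gt_of_ne hqx with h1 | h1 <;> rcases lt_or_gt_of_ne hne with h2 | h2 <;>
      simp [h1, h2, h1.not_gt, h2.not_gt] <;> ring

theorem prwWeight_eq_zero (p a b c α : R) {w : List ℕ} (h1 : 1 ∈ w) (hnd : w.Nodup)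
    (hw : ∀ y ∈ w, 1 ≤ y) (h : ¬ isPRW w) : prwWeight p a b c α w = 0 := by
  induction w with
  | nil => rfl
  | cons x r ih =>
    by_cases hx : x = 1
    · subst hx
      refine absurd (isPRW_one_cons fun y hy => ?_) h
      have := hw y (by simp [hy])
      have : 1 ≠ y := fun h => hnd.notMem (h ▸ hy)
      omega
    · have hr : 1 ∈ r := by simpa [Ne.symm hx] using h1
      cases r with
      | nil => simp at hr
      | cons y s =>
        rw [prwWeight, if_neg hx]
        rw [isPRW_cons_cons hx] at h
        split_ifs with hxy
        · rfl
        · rw [ih hr hnd.of_cons (fun z hz => hw z (by simp [hz])) (fun h' => h ⟨hxy, h'⟩), mul_zero]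

theorem prwWeight_eq (p a b c α : R) {N : ℕ} {w : List ℕ} (h1 : 1 ∈ w) (hnd : w.Nodup)
    (hw : ∀ y ∈ w, 1 ≤ y ∧ y < N) (h : isPRW w) : ∀ q, w.headD q < q →
    prwWeight p a b c α w = p ^ letterCount IsPeak N q w * a ^ letterCount IsDoubleAscent N q w *
        b ^ (letterCount IsDoubleDescent N q w + 1 - lrminW w) * c ^ (lrminW w - 1) *
        α ^ (lrminW w + rlminW w - 2) ∧
      1 ≤ lrminW w ∧ 1 ≤ rlminW w ∧ lrminW w ≤ letterCount IsDoubleDescent N q w + 1 := by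
  induction w with
  | nil => simp at h1
  | cons x r ih =>
    intro q hq
    have hxq : x < q := by simpa using hq
    have hxN := (hw x (by simp)).2
    by_cases hx : x = 1
    · subst hx
      have hr : ∀ y ∈ r, 1 < y := by
        intro y hy
        have := hw y (by simp [hy])
        have : 1 ≠ y := fun h => hnd.notMem (h ▸ hy)
        omega
      have hhead : 1 < r.headD N := by
        cases r with
        | nil => exact hxN
        | cons y s => exact hr y (by simp)
      rw [prwWeight, if_pos rfl, tailWeight_eq p a b α r 1 hnd (fun y hy => (hw y (by simp [hy])).2),
        lrminW_one_cons hr, rlminW_cons, if_pos hr, letterCount_cons, letterCount_cons,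
        letterCount_cons]
      generalize r.headD N = t at *
      simp [IsPeak, IsDoubleAscent, IsDoubleDescent, hxq.not_gt, hhead.not_gt, ← add_assoc]
    · have hr : 1 ∈ r := by simpa [Ne.symm hx] using h1
      cases r with
      | nil => simp at hr
      | cons y s =>
        rw [isPRW_cons_cons hx] at h
        have hyx : y < x := by
          have : x ≠ y := by
            rintro rfl
            exact hnd.notMem (by simp)
          omega
        obtain ⟨hF, hlr, hrl, hdd⟩ := ih hr hnd.of_cons (fun z hz => hw z (by simp [hz])) h.2 x hyx
        have hrlx : ¬ ∀ z ∈ y :: s, x < z := fun h => (h y (by simp)).not_gt hyx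
        rw [prwWeight, if_neg hx, List.headD_cons, if_neg hyx.not_gt, hF,
          letterCount_cons IsPeak N q x, letterCount_cons IsDoubleAscent N q x,
          letterCount_cons IsDoubleDescent N q x, lrminW_cons_cons hyx, rlminW_cons x, if_neg hrlx]
        generalize letterCount IsDoubleDescent N x (y :: s) = dd at *
        generalize lrminW (y :: s) = lr at *
        generalize rlminW (y :: s) = rl at *
        obtain ⟨k, rfl⟩ := Nat.exists_eq_add_of_le' hlr
        obtain ⟨l, rfl⟩ := Nat.exists_eq_add_of_le' hrl
        simp only [IsPeak, IsDoubleAscent, IsDoubleDescent, List.headD_cons, hxq, hxq.not_gt, hyx,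
          hyx.not_gt, and_self, and_true, if_true, if_false, zero_add]
        refine ⟨?_, by omega, by omega, by omega⟩
        rw [show 1 + dd + 1 - (1 + (k + 1)) = dd + 1 - (k + 1) by omega,
          show 1 + (k + 1) - 1 = k + 1 by omega, show k + 1 - 1 = k by omega,
          show 1 + (k + 1) + (l + 1) - 2 = k + l + 1 by omega,
          show k + 1 + (l + 1) - 2 = k + l by omega, pow_succ c, pow_succ α]
        ring

theorem wB_pred_ne {w : List ℕ} (hnd : w.Nodup) (hle : ∀ y ∈ w, y ≤ w.length) {i : ℕ}
    (h1 : 1 ≤ i) (h2 : i ≤ w.length) : wB w (i - 1) ≠ wB w i := by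
  obtain ⟨k, rfl⟩ := Nat.exists_eq_add_of_le' h1
  rw [Nat.add_sub_cancel]
  cases k with
  | zero =>
    have := hle _ (wB_mem le_rfl h2)
    have h0 : wB w 0 = w.length + 1 := by simp [wB]
    rw [h0]
    simp only [zero_add]
    omega
  | succ k =>
    rw [wB_eq_getElem (show k < w.length by omega), wB_eq_getElem (show k + 1 < w.length by omega)]
    intro h
    have := (hnd.getElem_inj_iff).1 h
    omega

theorem desW_eq_pkW_add_ddW {w : List ℕ} (hnd : w.Nodup) (hle : ∀ y ∈ w, y ≤ w.length) :
    desW w = pkW w + ddW w := by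
  rw [desW, pkW, ddW, ← Finset.card_union_of_disjoint]
  · congr 1
    ext i
    simp only [Finset.mem_union, Finset.mem_filter, Finset.mem_Icc, isPkat, isDDat]
    constructor
    · rintro ⟨hi, hlt⟩
      have := wB_pred_ne hnd hle hi.1 (by omega)
      omega
    · intro h
      have hi : 1 ≤ i ∧ i ≤ w.length := by omega
      have hlt : wB w (i + 1) < wB w i := by omega
      refine ⟨⟨hi.1, ?_⟩, hlt⟩
      by_contra hlast
      have := hle _ (wB_mem hi.1 hi.2)
      have hend : wB w (i + 1) = w.length + 1 := by
        rw [wB, if_neg (by omega)]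
      omega
  · rw [Finset.disjoint_filter]
    rintro i _ ⟨h1, _⟩ ⟨h2, _⟩
    omega

theorem ascW_eq_pkW_add_daW {w : List ℕ} (hnd : w.Nodup) (hle : ∀ y ∈ w, y ≤ w.length) :
    ascW w = pkW w + daW w := by
  have hsplit : pkW w + daW w =
      ((Finset.Icc 1 w.length).filter (fun i => wB w (i - 1) < wB w i)).card := by
    rw [pkW, daW, ← Finset.card_union_of_disjoint]
    · congr 1
      ext i
      simp only [Finset.mem_union, Finset.mem_filter, Finset.mem_Icc, isPkat, isDAat]
      constructor
      · omega
      · rintro ⟨hi, hlt⟩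
        rcases eq_or_lt_of_le hi.2 with h | h
        · have := hle _ (wB_mem hi.1 hi.2)
          have hend : wB w (i + 1) = w.length + 1 := by
            rw [wB, if_neg (by omega)]
          omega
        · have := wB_pred_ne hnd hle (show 1 ≤ i + 1 by omega) h
          rw [Nat.add_sub_cancel] at this
          omega
    · rw [Finset.disjoint_filter]
      rintro i _ ⟨_, h1⟩ ⟨_, h2⟩
      omega
  rw [hsplit, ascW]
  cases hlen : w.length with
  | zero => simp
  | succ n =>
    have hfirst : ¬ wB w (1 - 1) < wB w 1 := by
      have := hle _ (wB_mem le_rfl (show 1 ≤ w.length by omega))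
      have h0 : wB w (1 - 1) = w.length + 1 := by simp [wB]
      omega
    rw [card_filter_Icc_one_succ, if_neg hfirst, zero_add]
    simp only [Nat.add_sub_cancel]

theorem word_perm_descWord {n : ℕ} (σ : Equiv.Perm (Fin n)) : (word σ).Perm (descWord n) := by
  have hinj : Function.Injective fun i => (σ i : ℕ) + 1 := fun i j h =>
    σ.injective (Fin.ext (Nat.add_right_cancel h))
  unfold word
  rw [List.perm_ext_iff_of_nodup (List.nodup_ofFn.2 hinj) (nodup_descWord n)]
  intro y
  rw [mem_descWord, List.mem_ofFn]
  constructor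
  · rintro ⟨i, rfl⟩
    have := (σ i).isLt
    omega
  · intro hy
    exact ⟨σ.symm ⟨y - 1, by omega⟩, by simp; omega⟩

theorem word_injective (n : ℕ) : Function.Injective (word (n := n)) := by
  intro σ τ h
  ext i
  have := congrFun (List.ofFn_injective h) i
  exact Nat.add_right_cancel this

theorem length_descWord (n : ℕ) : (descWord n).length = n := by
  induction n with
  | zero => rfl
  | succ n ih => simp [descWord, ih]

theorem image_word_univ (n : ℕ) :
    Finset.univ.image (word (n := n)) = (descWord n).permutations'.toFinset := by
  refine Finset.eq_of_subset_of_card_le (fun w hw => ?_) ?_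
  · obtain ⟨σ, _, rfl⟩ := Finset.mem_image.1 hw
    simpa using word_perm_descWord σ
  · rw [Finset.card_image_of_injective _ (word_injective n), Finset.card_univ, Fintype.card_perm,
      Fintype.card_fin]
    refine (List.toFinset_card_le _).trans ?_
    rw [(List.permutations_perm_permutations' _).symm.length_eq, List.length_permutations,
      length_descWord]

theorem sum_prwWeight_word (p a b c α : R) (n : ℕ) :
    ∑ σ : Equiv.Perm (Fin n), prwWeight p a b c α (word σ) = prwSum p a b c α n := by
  have hnd : (descWord n).permutations'.Nodup :=
    (List.permutations_perm_permutations' _).nodup_iff.1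
      (List.nodup_permutations _ (nodup_descWord n))
  rw [prwSum, ← List.sum_toFinset _ hnd, ← image_word_univ,
    Finset.sum_image (word_injective n).injOn]

theorem word_properties {n : ℕ} (σ : Equiv.Perm (Fin (n + 1))) :
    1 ∈ word σ ∧ (word σ).Nodup ∧ (∀ y ∈ word σ, 1 ≤ y ∧ y ≤ n + 1) ∧ (word σ).length = n + 1 := by
  have h := word_perm_descWord σ
  refine ⟨?_, h.nodup_iff.2 (nodup_descWord _), fun y hy => ?_, by simp [word]⟩
  · simp [h.mem_iff, mem_descWord]
  · rwa [h.mem_iff, mem_descWord] at hy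

theorem headD_word_lt {n : ℕ} (σ : Equiv.Perm (Fin (n + 1))) :
    (word σ).headD ((word σ).length + 1) < (word σ).length + 1 := by
  obtain ⟨hone, -, hle, hlen⟩ := word_properties σ
  rw [hlen]
  cases hw : word σ with
  | nil => simp [hw] at hone
  | cons x r => exact Nat.lt_succ_of_le (hle x (by simp [hw])).2

theorem sum_PRW_eq_prwSum (p a b c α : R) (n : ℕ) :
    ∑ σ ∈ PRW (n + 1), p ^ pkW (word σ) * a ^ daW (word σ) *
        b ^ (ddW (word σ) + 1 - lrminW (word σ)) * c ^ (lrminW (word σ) - 1) *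
        α ^ (lrminW (word σ) + rlminW (word σ) - 2) = prwSum p a b c α (n + 1) := by
  rw [← sum_prwWeight_word, PRW, Finset.sum_filter]
  refine Finset.sum_congr rfl fun σ _ => ?_
  obtain ⟨hone, hnd, hle, hlen⟩ := word_properties σ
  split_ifs with h
  · rw [(prwWeight_eq p a b c α hone hnd (fun y hy => ⟨(hle y hy).1, by have := hle y hy; omega⟩) h
      (N := (word σ).length + 1) ((word σ).length + 1) ?_).1, pkW_eq_letterCount,
      daW_eq_letterCount, ddW_eq_letterCount]
    exact headD_word_lt σ
  · exact (prwWeight_eq_zero p a b c α hone hnd (fun y hy => (hle y hy).1) h).symm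

theorem sum_PRW_desW_ascW_eq_prwSum (x y z α : R) (n : ℕ) :
    ∑ σ ∈ PRW (n + 1), x ^ (desW (word σ) + 1 - lrminW (word σ)) * y ^ ascW (word σ) *
        z ^ (lrminW (word σ) - 1) * α ^ (lrminW (word σ) + rlminW (word σ) - 2) =
      prwSum (x * y) y x z α (n + 1) := by
  rw [← sum_PRW_eq_prwSum]
  refine Finset.sum_congr rfl fun σ hσ => ?_
  obtain ⟨hone, hnd, hle, hlen⟩ := word_properties σ
  have hlr : lrminW (word σ) ≤ ddW (word σ) + 1 := by
    rw [ddW_eq_letterCount]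
    exact (prwWeight_eq x y x z α hone hnd (fun y hy => ⟨(hle y hy).1, by have := hle y hy; omega⟩)
      (Finset.mem_filter.1 hσ).2 _ (headD_word_lt σ)).2.2.2
  have hle' : ∀ y ∈ word σ, y ≤ (word σ).length := fun y hy =>
    (hle y hy).2.trans_eq hlen.symm
  rw [desW_eq_pkW_add_ddW hnd hle', ascW_eq_pkW_add_daW hnd hle', add_assoc,
    Nat.add_sub_assoc hlr, pow_add, pow_add, mul_pow]
  ring

end Statistics

/-- Theorem 3.3 of the paper: for ring elements with
`x + y = u₃ + u₄`, `y + z = u₃ + u₅` and `x·y = u₁·u₂`, the two refined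
binomial-Stirling-Eulerian enumerators over `PRW_{n+1}` agree. -/
theorem binomialStirlingEulerian_refinement_var {R : Type*} [CommRing R] (n : ℕ) (hn : 1 ≤ n)
    (x y z u₁ u₂ u₃ u₄ u₅ α : R)
    (h₁ : x + y = u₃ + u₄) (h₂ : y + z = u₃ + u₅) (h₃ : x * y = u₁ * u₂) :
    ∑ σ ∈ PRW (n + 1), (u₁ * u₂) ^ pkW (word σ) * u₃ ^ daW (word σ) *
        u₄ ^ (ddW (word σ) + 1 - lrminW (word σ)) * u₅ ^ (lrminW (word σ) - 1) *
        α ^ (lrminW (word σ) + rlminW (word σ) - 2)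
      = ∑ σ ∈ PRW (n + 1), x ^ (desW (word σ) + 1 - lrminW (word σ)) * y ^ ascW (word σ) *
          z ^ (lrminW (word σ) - 1) * α ^ (lrminW (word σ) + rlminW (word σ) - 2) := by
  rw [sum_PRW_eq_prwSum, sum_PRW_desW_ascW_eq_prwSum, h₃]
  exact prwSum_eq_of_add_eq α (by rw [← h₁, add_comm]) h₂.symm n
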